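/- Let Σ ∈ ℂ^{n×n} be Hermitian (not necessarily positive definite). There exists H ∈ ℂ^{m×n} such that Σ − AΣA* = BH + H*B* if and only if Σ ∈ Range Γ, i.e., if and only if there exists a continuous Hermitian-m×m-matrix-valued function Φ on 𝕋 with ∫ G Φ G* = Σ. -/

import Mathlib

open Matrix MeasureTheory
open scoped ComplexOrder

/-- Entrywise integral over the unit circle, `∫_{-π}^{π} F(e^{jθ}) dθ/2π`. -/
noncomputable def circleIntM {n m : ℕ} (F : ℝ → Matrix (Fin n) (Fin m) ℂ) :
    Matrix (Fin n) (Fin m) ℂ :=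
  Matrix.of fun i j => (2 * (Real.pi : ℂ))⁻¹ * ∫ θ in (-Real.pi)..Real.pi, F θ i j

/-- The transfer function `G(z) = (zI - A)⁻¹ B` evaluated at `z = e^{jθ}`. -/
noncomputable def Gfun {n m : ℕ} (A : Matrix (Fin n) (Fin n) ℂ)
    (B : Matrix (Fin n) (Fin m) ℂ) (θ : ℝ) : Matrix (Fin n) (Fin m) ℂ :=
  (Complex.exp (θ * Complex.I) • (1 : Matrix (Fin n) (Fin n) ℂ) - A)⁻¹ * B

/-- The pair `(A, B)` is reachable: the controllability matrix
`[B, AB, ..., A^{n-1}B]` has rank `n`. -/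
noncomputable def IsReachable {n m : ℕ} (A : Matrix (Fin n) (Fin n) ℂ)
    (B : Matrix (Fin n) (Fin m) ℂ) : Prop :=
  (Matrix.of fun (i : Fin n) (p : Fin n × Fin m) => (A ^ (p.1 : ℕ) * B) i p.2).rank = n

section Powers

lemma tendsto_pow_zero_of_spectrum_lt_one {R : Type*} [NormedRing R] [NormedAlgebra ℂ R]
    [CompleteSpace R] (a : R) (ha : ∀ z ∈ spectrum ℂ a, ‖z‖ < 1) :
    Filter.Tendsto (fun k : ℕ => a ^ k) Filter.atTop (nhds 0) := by
  rcases subsingleton_or_nontrivial R with h | h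
  · exact tendsto_const_nhds.congr fun _ => Subsingleton.elim _ _
  have hr : spectralRadius ℂ a < (1 : NNReal) :=
    spectrum.spectralRadius_lt_of_forall_lt a fun z hz => by exact_mod_cast ha z hz
  obtain ⟨r, hr1, hr2⟩ := ENNReal.lt_iff_exists_nnreal_btwn.mp hr
  have hr2' : r < 1 := by exact_mod_cast hr2
  have hev := (spectrum.pow_nnnorm_pow_one_div_tendsto_nhds_spectralRadius a).eventually
    (gt_mem_nhds hr1)
  rw [tendsto_zero_iff_norm_tendsto_zero]
  refine squeeze_zero' (Filter.Eventually.of_forall fun _ => norm_nonneg _) ?_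
    (tendsto_pow_atTop_nhds_zero_of_lt_one r.2 (by exact_mod_cast hr2'))
  filter_upwards [hev, Filter.eventually_gt_atTop 0] with k hk hk0
  have hk0' : (0 : ℝ) < k := by exact_mod_cast hk0
  have h1 := ENNReal.rpow_le_rpow hk.le hk0'.le
  rw [← ENNReal.rpow_mul, one_div, inv_mul_cancel₀ hk0'.ne', ENNReal.rpow_one,
    ENNReal.rpow_natCast] at h1
  have h2 : ‖a ^ k‖₊ ≤ r ^ k := by exact_mod_cast h1
  exact_mod_cast h2

attribute [local instance] Matrix.linftyOpNormedRing Matrix.linftyOpNormedAlgebra in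
lemma Matrix.tendsto_pow_zero_of_spectrum_lt_one {n : ℕ} (A : Matrix (Fin n) (Fin n) ℂ)
    (hA : ∀ z ∈ spectrum ℂ A, ‖z‖ < 1) :
    Filter.Tendsto (fun k : ℕ => A ^ k) Filter.atTop (nhds 0) :=
  _root_.tendsto_pow_zero_of_spectrum_lt_one A hA

/-- A matrix with spectrum in the open unit disc admits no nonzero fixed point of `S ↦ A S Aᴴ`. -/
lemma Matrix.eq_zero_of_eq_mul_mul_conjTranspose {n : ℕ} {A S : Matrix (Fin n) (Fin n) ℂ}
    (hA : ∀ z ∈ spectrum ℂ A, ‖z‖ < 1) (hS : S = A * S * Aᴴ) : S = 0 := by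
  have hk : ∀ k : ℕ, A ^ k * S * (A ^ k)ᴴ = S := by
    intro k
    induction k with
    | zero => simp
    | succ k ih =>
      calc A ^ (k + 1) * S * (A ^ (k + 1))ᴴ = A ^ k * (A * S * Aᴴ) * (A ^ k)ᴴ := by
            rw [pow_succ, conjTranspose_mul]; simp only [Matrix.mul_assoc]
        _ = S := by rw [← hS, ih]
  have hA0 := Matrix.tendsto_pow_zero_of_spectrum_lt_one A hA
  have hcont : Continuous fun X : Matrix (Fin n) (Fin n) ℂ => X * S * Xᴴ := by fun_prop
  have hlim := (hcont.tendsto 0).comp hA0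
  simp only [Function.comp_def, hk, Matrix.zero_mul] at hlim
  exact tendsto_nhds_unique tendsto_const_nhds hlim

end Powers

section CircleIntegral

variable {n m p : ℕ}

lemma circleIntM_add {F F' : ℝ → Matrix (Fin n) (Fin m) ℂ} (hF : Continuous F)
    (hF' : Continuous F') :
    circleIntM (fun θ => F θ + F' θ) = circleIntM F + circleIntM F' := by
  ext i j
  simp only [circleIntM, of_apply, Matrix.add_apply]
  rw [intervalIntegral.integral_add ((hF.matrix_elem i j).intervalIntegrable _ _)
    ((hF'.matrix_elem i j).intervalIntegrable _ _), mul_add]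

lemma circleIntM_sub {F F' : ℝ → Matrix (Fin n) (Fin m) ℂ} (hF : Continuous F)
    (hF' : Continuous F') :
    circleIntM (fun θ => F θ - F' θ) = circleIntM F - circleIntM F' := by
  ext i j
  simp only [circleIntM, of_apply, Matrix.sub_apply]
  rw [intervalIntegral.integral_sub ((hF.matrix_elem i j).intervalIntegrable _ _)
    ((hF'.matrix_elem i j).intervalIntegrable _ _), mul_sub]

lemma circleIntM_conjTranspose (F : ℝ → Matrix (Fin n) (Fin m) ℂ) :
    circleIntM (fun θ => (F θ)ᴴ) = (circleIntM F)ᴴ := by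
  ext i j
  simp only [circleIntM, of_apply, conjTranspose_apply, RCLike.star_def,
    intervalIntegral.intervalIntegral_conj, map_mul, map_inv₀, Complex.conj_ofReal, map_ofNat]

lemma circleIntM_mul_left (C : Matrix (Fin p) (Fin n) ℂ) {F : ℝ → Matrix (Fin n) (Fin m) ℂ}
    (hF : Continuous F) : circleIntM (fun θ => C * F θ) = C * circleIntM F := by
  ext i j
  simp only [circleIntM, of_apply, Matrix.mul_apply]
  rw [intervalIntegral.integral_finsetSum fun k _ =>
    ((hF.matrix_elem k j).const_mul _).intervalIntegrable _ _, Finset.mul_sum]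
  refine Finset.sum_congr rfl fun k _ => ?_
  rw [intervalIntegral.integral_const_mul]
  ring

lemma circleIntM_mul_right (C : Matrix (Fin m) (Fin p) ℂ) {F : ℝ → Matrix (Fin n) (Fin m) ℂ}
    (hF : Continuous F) : circleIntM (fun θ => F θ * C) = circleIntM F * C := by
  have h := circleIntM_mul_left Cᴴ hF.matrix_conjTranspose
  simp only [← conjTranspose_mul, circleIntM_conjTranspose] at h
  exact conjTranspose_injective h

/-- The point `e^{jθ}` of the unit circle. -/
noncomputable def unitPt (θ : ℝ) : ℂ := Complex.exp (θ * Complex.I)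

lemma unitPt_ne_zero (θ : ℝ) : unitPt θ ≠ 0 := Complex.exp_ne_zero _

lemma norm_unitPt (θ : ℝ) : ‖unitPt θ‖ = 1 := Complex.norm_exp_ofReal_mul_I θ

lemma star_unitPt (θ : ℝ) : star (unitPt θ) = (unitPt θ)⁻¹ :=
  (Complex.inv_eq_conj (norm_unitPt θ)).symm

lemma unitPt_periodic : Function.Periodic unitPt (2 * Real.pi) := by
  intro θ
  simp only [unitPt, Complex.ofReal_add, Complex.ofReal_mul, Complex.ofReal_ofNat, add_mul,
    Complex.exp_add, Complex.exp_two_pi_mul_I, mul_one]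

lemma continuous_unitPt : Continuous unitPt := by
  unfold unitPt; fun_prop

lemma continuous_unitPt_zpow (l : ℤ) : Continuous fun θ => unitPt θ ^ l :=
  continuous_unitPt.zpow₀ l fun θ => Or.inl (unitPt_ne_zero θ)

lemma integral_unitPt_zpow (l : ℤ) :
    (2 * (Real.pi : ℂ))⁻¹ * ∫ θ in (-Real.pi)..Real.pi, unitPt θ ^ l = if l = 0 then 1 else 0 := by
  have hpi : (Real.pi : ℂ) ≠ 0 := by exact_mod_cast Real.pi_ne_zero
  split_ifs with hl
  · subst hl
    simp only [zpow_zero, intervalIntegral.integral_const]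
    rw [show Real.pi - -Real.pi = 2 * Real.pi by ring, Complex.real_smul, mul_one]
    push_cast
    exact inv_mul_cancel₀ (mul_ne_zero two_ne_zero hpi)
  · have hc : (l * Complex.I : ℂ) ≠ 0 := by simp [hl]
    have h : ∀ θ : ℝ, unitPt θ ^ l = Complex.exp (l * Complex.I * θ) := fun θ => by
      rw [unitPt, ← Complex.exp_int_mul]; ring_nf
    simp only [h]
    rw [integral_exp_mul_complex hc]
    have : Complex.exp (l * Complex.I * (Real.pi : ℝ))
        = Complex.exp (l * Complex.I * ((-Real.pi : ℝ) : ℂ)) := by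
      rw [Complex.exp_eq_exp_iff_exists_int]
      exact ⟨l, by push_cast; ring⟩
    rw [this]; simp

lemma circleIntM_unitPt_zpow_smul (l : ℤ) (C : Matrix (Fin n) (Fin m) ℂ) :
    circleIntM (fun θ => unitPt θ ^ l • C) = if l = 0 then C else 0 := by
  ext i j
  simp only [circleIntM, of_apply, Matrix.smul_apply, smul_eq_mul,
    intervalIntegral.integral_mul_const]
  rw [← mul_assoc, integral_unitPt_zpow]
  split_ifs <;> simp

end CircleIntegral

section Transfer

variable {n m : ℕ} {A : Matrix (Fin n) (Fin n) ℂ} {B : Matrix (Fin n) (Fin m) ℂ}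

lemma isUnit_det_unitPt_smul_sub (hA : ∀ z ∈ spectrum ℂ A, ‖z‖ < 1) (θ : ℝ) :
    IsUnit (unitPt θ • (1 : Matrix (Fin n) (Fin n) ℂ) - A).det := by
  rw [← isUnit_iff_isUnit_det]
  by_contra h
  have := hA (unitPt θ) (by rwa [spectrum.mem_iff, Algebra.algebraMap_eq_smul_one])
  rw [norm_unitPt] at this
  exact lt_irrefl _ this

lemma unitPt_smul_Gfun (hA : ∀ z ∈ spectrum ℂ A, ‖z‖ < 1) (B : Matrix (Fin n) (Fin m) ℂ) (θ : ℝ) :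
    unitPt θ • Gfun A B θ = A * Gfun A B θ + B := by
  have h : (unitPt θ • (1 : Matrix (Fin n) (Fin n) ℂ) - A) * Gfun A B θ = B :=
    mul_nonsing_inv_cancel_left _ B (isUnit_det_unitPt_smul_sub hA θ)
  rw [Matrix.sub_mul, Matrix.smul_mul, Matrix.one_mul, sub_eq_iff_eq_add'] at h
  exact h

lemma continuous_Gfun (hA : ∀ z ∈ spectrum ℂ A, ‖z‖ < 1) (B : Matrix (Fin n) (Fin m) ℂ) :
    Continuous (Gfun A B) := by
  have hc : Continuous fun θ => unitPt θ • (1 : Matrix (Fin n) (Fin n) ℂ) - A :=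
    (continuous_unitPt.smul continuous_const).sub continuous_const
  have hinv : Continuous fun θ => (unitPt θ • (1 : Matrix (Fin n) (Fin n) ℂ) - A)⁻¹ := by
    simp only [Matrix.inv_def, Ring.inverse_eq_inv']
    exact (hc.matrix_det.inv₀ fun θ => (isUnit_det_unitPt_smul_sub hA θ).ne_zero).smul
      hc.matrix_adjugate
  exact hinv.matrix_mul continuous_const

/-- The moment `∫ z^l G(z)` of the transfer function. -/
noncomputable def moment (A : Matrix (Fin n) (Fin n) ℂ) (B : Matrix (Fin n) (Fin m) ℂ) (l : ℤ) :
    Matrix (Fin n) (Fin m) ℂ :=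
  circleIntM fun θ => unitPt θ ^ l • Gfun A B θ

lemma moment_add_one (hA : ∀ z ∈ spectrum ℂ A, ‖z‖ < 1) (B : Matrix (Fin n) (Fin m) ℂ) (l : ℤ) :
    moment A B (l + 1) = A * moment A B l + if l = 0 then B else 0 := by
  have hG := continuous_Gfun hA B
  have hz : Continuous fun θ => unitPt θ ^ l • Gfun A B θ := (continuous_unitPt_zpow l).smul hG
  have h : ∀ θ, unitPt θ ^ (l + 1) • Gfun A B θ
      = A * (unitPt θ ^ l • Gfun A B θ) + unitPt θ ^ l • B := fun θ => by
    rw [zpow_add_one₀ (unitPt_ne_zero θ), mul_smul, unitPt_smul_Gfun hA, smul_add,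
      Matrix.mul_smul]
  simp only [moment, h]
  have hB : Continuous fun θ => unitPt θ ^ l • B :=
    (continuous_unitPt_zpow l).smul continuous_const
  rw [circleIntM_add (continuous_const.matrix_mul hz) hB, circleIntM_mul_left A hz,
    circleIntM_unitPt_zpow_smul]

lemma moment_eq_pow_mul (hA : ∀ z ∈ spectrum ℂ A, ‖z‖ < 1) (B : Matrix (Fin n) (Fin m) ℂ)
    {l : ℤ} (hl : l ≤ 0) (k : ℕ) : moment A B l = A ^ k * moment A B (l - k) := by
  induction k with
  | zero => simp
  | succ k ih =>
    have h := moment_add_one hA B (l - (k + 1 : ℕ))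
    rw [if_neg (by push_cast; omega), add_zero] at h
    rw [ih, pow_succ, Matrix.mul_assoc, ← h]
    congr 2
    push_cast; ring

lemma exists_norm_moment_le (A : Matrix (Fin n) (Fin n) ℂ) (B : Matrix (Fin n) (Fin m) ℂ)
    (i : Fin n) (j : Fin m) : ∃ C, ∀ l, ‖moment A B l i j‖ ≤ C := by
  refine ⟨‖(2 * (Real.pi : ℂ))⁻¹‖ * ∫ θ in (-Real.pi)..Real.pi, ‖Gfun A B θ i j‖, fun l => ?_⟩
  simp only [moment, circleIntM, of_apply, norm_mul]
  refine mul_le_mul_of_nonneg_left ?_ (norm_nonneg _)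
  refine (intervalIntegral.norm_integral_le_integral_norm
    (by linarith [Real.pi_pos])).trans_eq ?_
  simp [norm_zpow, norm_unitPt]

lemma moment_of_nonpos (hA : ∀ z ∈ spectrum ℂ A, ‖z‖ < 1) (B : Matrix (Fin n) (Fin m) ℂ)
    {l : ℤ} (hl : l ≤ 0) : moment A B l = 0 := by
  ext i j
  have hA0 := Matrix.tendsto_pow_zero_of_spectrum_lt_one A hA
  have hlim : Filter.Tendsto (fun k : ℕ => (A ^ k * moment A B (l - k)) i j) Filter.atTop
      (nhds 0) := by
    simp only [Matrix.mul_apply]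
    rw [← Finset.sum_const_zero (s := (Finset.univ : Finset (Fin n)))]
    refine tendsto_finsetSum _ fun q _ => ?_
    obtain ⟨C, hC⟩ := exists_norm_moment_le A B q j
    have hq : Filter.Tendsto (fun k : ℕ => (A ^ k) i q) Filter.atTop (nhds 0) :=
      ((continuous_id.matrix_elem i q).tendsto (0 : Matrix (Fin n) (Fin n) ℂ)).comp hA0
    exact hq.zero_mul_isBoundedUnder_le
      (Filter.isBoundedUnder_of ⟨C, fun k => hC (l - k)⟩)
  simp only [← moment_eq_pow_mul hA B hl] at hlim
  exact tendsto_nhds_unique tendsto_const_nhds hlim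

lemma moment_natCast_add_one (hA : ∀ z ∈ spectrum ℂ A, ‖z‖ < 1) (B : Matrix (Fin n) (Fin m) ℂ)
    (k : ℕ) : moment A B (k + 1) = A ^ k * B := by
  induction k with
  | zero => simpa [moment_of_nonpos hA B le_rfl] using moment_add_one hA B 0
  | succ k ih =>
    rw [moment_add_one hA, if_neg (by omega), add_zero, Nat.cast_succ, ih, pow_succ',
      Matrix.mul_assoc]

lemma continuous_Gfun_mul_mul (hA : ∀ z ∈ spectrum ℂ A, ‖z‖ < 1) (B : Matrix (Fin n) (Fin m) ℂ)
    {Φ : ℝ → Matrix (Fin m) (Fin m) ℂ} (hΦ : Continuous Φ) :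
    Continuous fun θ => Gfun A B θ * Φ θ * (Gfun A B θ)ᴴ :=
  ((continuous_Gfun hA B).matrix_mul hΦ).matrix_mul (continuous_Gfun hA B).matrix_conjTranspose

/-- The Lyapunov-type identity satisfied by a state covariance. -/
lemma circleIntM_lyapunov (hA : ∀ z ∈ spectrum ℂ A, ‖z‖ < 1) (B : Matrix (Fin n) (Fin m) ℂ)
    {Φ : ℝ → Matrix (Fin m) (Fin m) ℂ} (hΦ : Continuous Φ) (hH : ∀ θ, (Φ θ).IsHermitian) :
    let S := circleIntM fun θ => Gfun A B θ * Φ θ * (Gfun A B θ)ᴴ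
    let N := circleIntM fun θ => (unitPt θ • Gfun A B θ) * Φ θ
    S - A * S * Aᴴ = N * Bᴴ + B * Nᴴ - B * circleIntM Φ * Bᴴ := by
  intro S N
  have hG := continuous_Gfun hA B
  have hS := continuous_Gfun_mul_mul hA B hΦ
  have hT : Continuous fun θ => unitPt θ • Gfun A B θ := continuous_unitPt.smul hG
  have hN : Continuous fun θ => (unitPt θ • Gfun A B θ) * Φ θ := hT.matrix_mul hΦ
  have hBN : Continuous fun θ => B * ((unitPt θ • Gfun A B θ) * Φ θ)ᴴ :=
    continuous_const.matrix_mul hN.matrix_conjTranspose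
  have hNB : Continuous fun θ => (unitPt θ • Gfun A B θ) * Φ θ * Bᴴ :=
    hN.matrix_mul continuous_const
  have hBΦ : Continuous fun θ => B * Φ θ := continuous_const.matrix_mul hΦ
  have hAS : Continuous fun θ => A * (Gfun A B θ * Φ θ * (Gfun A B θ)ᴴ) :=
    continuous_const.matrix_mul hS
  have key : ∀ θ, Gfun A B θ * Φ θ * (Gfun A B θ)ᴴ
      - A * (Gfun A B θ * Φ θ * (Gfun A B θ)ᴴ) * Aᴴ
      = (unitPt θ • Gfun A B θ) * Φ θ * Bᴴ + B * ((unitPt θ • Gfun A B θ) * Φ θ)ᴴ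
        - B * Φ θ * Bᴴ := by
    intro θ
    have h1 : Gfun A B θ * Φ θ * (Gfun A B θ)ᴴ
        = (unitPt θ • Gfun A B θ) * Φ θ * (unitPt θ • Gfun A B θ)ᴴ := by
      rw [conjTranspose_smul, Matrix.smul_mul, Matrix.smul_mul, Matrix.mul_smul, smul_smul,
        star_unitPt, mul_inv_cancel₀ (unitPt_ne_zero θ), one_smul]
    have h2 : A * (Gfun A B θ * Φ θ * (Gfun A B θ)ᴴ) * Aᴴ
        = (A * Gfun A B θ) * Φ θ * (A * Gfun A B θ)ᴴ := by
      rw [conjTranspose_mul]; simp only [Matrix.mul_assoc]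
    rw [h2, h1, unitPt_smul_Gfun hA, conjTranspose_mul (_ + _) (Φ θ), (hH θ).eq,
      conjTranspose_add]
    simp only [Matrix.mul_add, Matrix.add_mul, Matrix.mul_assoc]
    abel
  calc S - A * S * Aᴴ
      = circleIntM fun θ => Gfun A B θ * Φ θ * (Gfun A B θ)ᴴ
        - A * (Gfun A B θ * Φ θ * (Gfun A B θ)ᴴ) * Aᴴ := by
        rw [circleIntM_sub hS (hAS.matrix_mul continuous_const), circleIntM_mul_right _ hAS,
          circleIntM_mul_left _ hS]
    _ = N * Bᴴ + B * Nᴴ - B * circleIntM Φ * Bᴴ := by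
        simp only [key]
        rw [circleIntM_sub (hNB.fun_add hBN) (hBΦ.matrix_mul continuous_const),
          circleIntM_add hNB hBN, circleIntM_mul_right _ hN,
          circleIntM_mul_left _ hN.matrix_conjTranspose, circleIntM_conjTranspose,
          circleIntM_mul_right _ hBΦ, circleIntM_mul_left _ hΦ]

/-- `K` is realized when some continuous Hermitian density has a covariance `S` with
`S - A S Aᴴ = K Bᴴ + B Kᴴ`. -/
def IsRealized (A : Matrix (Fin n) (Fin n) ℂ) (B K : Matrix (Fin n) (Fin m) ℂ) : Prop :=
  ∃ Φ : ℝ → Matrix (Fin m) (Fin m) ℂ,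
    Continuous Φ ∧ Function.Periodic Φ (2 * Real.pi) ∧ (∀ θ : ℝ, (Φ θ).IsHermitian) ∧
    (circleIntM fun θ => Gfun A B θ * Φ θ * (Gfun A B θ)ᴴ)
      - A * (circleIntM fun θ => Gfun A B θ * Φ θ * (Gfun A B θ)ᴴ) * Aᴴ = K * Bᴴ + B * Kᴴ

lemma IsRealized.zero : IsRealized A B 0 :=
  ⟨fun _ => 0, continuous_const, fun _ => rfl, fun _ => isHermitian_zero, by
    have : (circleIntM fun _ => (0 : Matrix (Fin n) (Fin n) ℂ)) = 0 := by
      ext i j; simp [circleIntM]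
    simp [this]⟩

lemma IsRealized.add (hA : ∀ z ∈ spectrum ℂ A, ‖z‖ < 1) {K L : Matrix (Fin n) (Fin m) ℂ}
    (hK : IsRealized A B K) (hL : IsRealized A B L) : IsRealized A B (K + L) := by
  obtain ⟨Φ, hc, hp, hh, hK⟩ := hK
  obtain ⟨Ψ, hc', hp', hh', hL⟩ := hL
  refine ⟨fun θ => Φ θ + Ψ θ, hc.add hc', hp.add hp', fun θ => (hh θ).add (hh' θ), ?_⟩
  simp only [Matrix.mul_add, Matrix.add_mul]
  rw [circleIntM_add (continuous_Gfun_mul_mul hA B hc) (continuous_Gfun_mul_mul hA B hc'),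
    conjTranspose_add]
  simp only [Matrix.mul_add, Matrix.add_mul]
  rw [add_sub_add_comm, hK, hL]
  abel

lemma IsRealized.pow_mul_mul (hA : ∀ z ∈ spectrum ℂ A, ‖z‖ < 1) (B : Matrix (Fin n) (Fin m) ℂ)
    (k : ℕ) (Z : Matrix (Fin m) (Fin m) ℂ) : IsRealized A B (A ^ k * B * Z) := by
  set Φ : ℝ → Matrix (Fin m) (Fin m) ℂ :=
    fun θ => unitPt θ ^ (-k : ℤ) • Zᴴ + unitPt θ ^ (k : ℤ) • Z with hΦdef
  have hc₁ : Continuous fun θ => unitPt θ ^ (-k : ℤ) • Zᴴ :=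
    (continuous_unitPt_zpow _).smul continuous_const
  have hc₂ : Continuous fun θ => unitPt θ ^ (k : ℤ) • Z :=
    (continuous_unitPt_zpow _).smul continuous_const
  have hc : Continuous Φ := hc₁.add hc₂
  have hh : ∀ θ, (Φ θ).IsHermitian := fun θ => by
    simp only [hΦdef, IsHermitian, conjTranspose_add, conjTranspose_smul, star_zpow₀,
      star_unitPt, conjTranspose_conjTranspose, _root_.inv_zpow', neg_neg]
    exact add_comm _ _
  have hp : Function.Periodic Φ (2 * Real.pi) := fun θ => by
    simp only [hΦdef, unitPt_periodic θ]
  refine ⟨Φ, hc, hp, hh, ?_⟩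
  have hmom : ∀ l : ℤ, Continuous fun θ => unitPt θ ^ l • Gfun A B θ := fun l =>
    (continuous_unitPt_zpow l).smul (continuous_Gfun hA B)
  have hN : (circleIntM fun θ => (unitPt θ • Gfun A B θ) * Φ θ)
      = moment A B (-k + 1) * Zᴴ + moment A B (k + 1) * Z := by
    have h : ∀ θ, (unitPt θ • Gfun A B θ) * Φ θ
        = (unitPt θ ^ (-k + 1 : ℤ) • Gfun A B θ) * Zᴴ
          + (unitPt θ ^ (k + 1 : ℤ) • Gfun A B θ) * Z := fun θ => by
      simp only [hΦdef, Matrix.mul_add, Matrix.mul_smul, Matrix.smul_mul, smul_smul,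
        zpow_add_one₀ (unitPt_ne_zero θ)]
    simp only [h]
    rw [circleIntM_add ((hmom _).matrix_mul continuous_const)
      ((hmom _).matrix_mul continuous_const), circleIntM_mul_right _ (hmom _),
      circleIntM_mul_right _ (hmom _)]
    rfl
  have hP : circleIntM Φ = if k = 0 then Zᴴ + Z else 0 := by
    rw [hΦdef, circleIntM_add hc₁ hc₂, circleIntM_unitPt_zpow_smul, circleIntM_unitPt_zpow_smul]
    split_ifs <;> simp_all
  have key := circleIntM_lyapunov hA B hc hh
  simp only at key
  rw [key, hN, hP, moment_natCast_add_one hA]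
  rcases Nat.eq_zero_or_pos k with rfl | hk
  · have h1 := moment_natCast_add_one hA B 0
    simp only [Nat.cast_zero, neg_zero, zero_add, pow_zero, Matrix.one_mul] at h1 ⊢
    rw [h1]
    simp only [if_true, conjTranspose_add, conjTranspose_mul, conjTranspose_conjTranspose,
      Matrix.mul_add, Matrix.add_mul, Matrix.mul_assoc]
    abel
  · rw [moment_of_nonpos hA B (by omega), if_neg hk.ne']
    simp

lemma IsReachable.exists_eq_sum (hAB : IsReachable A B) (K : Matrix (Fin n) (Fin m) ℂ) :
    ∃ Z : Fin n → Matrix (Fin m) (Fin m) ℂ, K = ∑ k : Fin n, A ^ (k : ℕ) * B * Z k := by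
  set R := Matrix.of fun (i : Fin n) (p : Fin n × Fin m) => (A ^ (p.1 : ℕ) * B) i p.2 with hR
  have hsurj : Function.Surjective R.mulVec := by
    have : LinearMap.range R.mulVecLin = ⊤ :=
      Submodule.eq_top_of_finrank_eq (by
        rw [Module.finrank_fin_fun]; exact hAB)
    exact LinearMap.range_eq_top.mp this
  obtain ⟨Y, hY⟩ := mulVec_surjective_iff_exists_right_inverse.mp hsurj
  refine ⟨fun k => Matrix.of fun a b => (Y * K) (k, a) b, ?_⟩
  conv_lhs => rw [← Matrix.one_mul K, ← hY, Matrix.mul_assoc]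
  ext i j
  rw [Matrix.mul_apply, Fintype.sum_prod_type, Matrix.sum_apply]
  rfl

end Transfer

theorem stmt1 {n m : ℕ} (A : Matrix (Fin n) (Fin n) ℂ) (B : Matrix (Fin n) (Fin m) ℂ)
    (hA : ∀ z ∈ spectrum ℂ A, ‖z‖ < 1) (hB : B.rank = m) (hAB : IsReachable A B)
    (Sg : Matrix (Fin n) (Fin n) ℂ) (hSg : Sg.IsHermitian) :
    (∃ H : Matrix (Fin m) (Fin n) ℂ, Sg - A * Sg * Aᴴ = B * H + Hᴴ * Bᴴ) ↔
      (∃ Φ : ℝ → Matrix (Fin m) (Fin m) ℂ,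
        Continuous Φ ∧ Function.Periodic Φ (2 * Real.pi) ∧
        (∀ θ : ℝ, (Φ θ).IsHermitian) ∧
        circleIntM (fun θ => Gfun A B θ * Φ θ * (Gfun A B θ)ᴴ) = Sg) := by
  constructor
  · rintro ⟨H, hH⟩
    obtain ⟨Z, hZ⟩ := hAB.exists_eq_sum Hᴴ
    have hreal : IsRealized A B Hᴴ := by
      rw [hZ]
      exact Finset.sum_induction _ (IsRealized A B) (fun _ _ h h' => h.add hA h') IsRealized.zero
        fun k _ => IsRealized.pow_mul_mul hA B k (Z k)
    obtain ⟨Φ, hc, hp, hh, hΦ⟩ := hreal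
    refine ⟨Φ, hc, hp, hh, ?_⟩
    rw [conjTranspose_conjTranspose, add_comm, ← hH] at hΦ
    refine sub_eq_zero.mp (Matrix.eq_zero_of_eq_mul_mul_conjTranspose hA ?_)
    rw [Matrix.mul_sub, Matrix.sub_mul]
    exact sub_eq_sub_iff_sub_eq_sub.mp hΦ
  · rintro ⟨Φ, hc, -, hh, rfl⟩
    refine ⟨(circleIntM fun θ => (unitPt θ • Gfun A B θ) * Φ θ)ᴴ
      - (2 : ℂ)⁻¹ • (circleIntM Φ * Bᴴ), ?_⟩
    have hP : (circleIntM Φ)ᴴ = circleIntM Φ := by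
      rw [← circleIntM_conjTranspose]
      simp only [(hh _).eq]
    rw [circleIntM_lyapunov hA B hc hh]
    simp only [conjTranspose_sub, conjTranspose_conjTranspose, conjTranspose_smul,
      conjTranspose_mul, hP, Matrix.mul_sub, Matrix.sub_mul, Matrix.mul_smul, Matrix.smul_mul,
      Matrix.mul_assoc, star_inv₀, star_ofNat]
    module
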